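/- For every real t with 0 < t < 1 and every real χ > 0: each series defining F_{t,χ}(L,x) converges absolutely; F_{t,χ}(L,x) ≥ 0 for all L ∈ ℤ and x ∈ ℤ_{≥0}; and Σ_{L∈ℤ} Σ_{x=0}^{∞} F_{t,χ}(L,x) = 1. -/

import Mathlib

open scoped BigOperators

/-- `(t;t)_n = ∏_{r=1}^{n} (1 - t^r)`. -/
noncomputable def tPochN (t : ℝ) (n : ℕ) : ℝ := ∏ r ∈ Finset.range n, (1 - t ^ (r + 1))

/-- `(t;t)_∞ = ∏_{r=1}^{∞} (1 - t^r)`. -/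
noncomputable def tPochInf (t : ℝ) : ℝ := ∏' r : ℕ, (1 - t ^ (r + 1))

/-- The `t`-binomial coefficient `[n choose c]_t` for natural `c ≤ n`, `0` otherwise. -/
noncomputable def tBinomN (t : ℝ) (n c : ℕ) : ℝ :=
  if c ≤ n then tPochN t n / (tPochN t c * tPochN t (n - c)) else 0

/-- The `m`-th term of the series defining `F_{t,χ}(L,x)`. -/
noncomputable def Fterm (t χ : ℝ) (L : ℤ) (x m : ℕ) : ℝ :=
  Real.exp (-χ * t ^ (L - (m : ℤ))) * (-1) ^ m *
    t ^ ((m : ℤ) ^ 2 + ((x : ℤ) - 1) * (m : ℤ) + (x : ℤ) * ((x : ℤ) - 1) / 2) *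
    ∑ i ∈ Finset.range (x + 1),
      ((-1) ^ (x - i) / tPochN t (x - i)) * tBinomN t (m + i) i *
        ((t ^ (L - (m : ℤ)) * χ) ^ (i + m) / ((i + m).factorial : ℝ) +
          if 1 ≤ i + m then (t ^ (L - (m : ℤ)) * χ) ^ (i + m - 1) / (((i + m - 1).factorial : ℝ))
          else 0)

/-- `F_{t,χ}(L,x) = Pr(𝓛_{2,t,χ} = (L+x,L))`. -/
noncomputable def Fweight (t χ : ℝ) (L : ℤ) (x : ℕ) : ℝ :=
  (tPochInf t)⁻¹ * ∑' m : ℕ, Fterm t χ L x m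


lemma tPochN_succ (t : ℝ) (n : ℕ) : tPochN t (n+1) = tPochN t n * (1 - t^(n+1)) := by
  simp [tPochN, Finset.prod_range_succ]

lemma tPochN_zero (t : ℝ) : tPochN t 0 = 1 := by simp [tPochN]

lemma one_sub_pow_pos' {t : ℝ} (ht0 : 0 < t) (ht1 : t < 1) (n : ℕ) : 0 < 1 - t^(n+1) := by
  have : t^(n+1) < 1 := pow_lt_one₀ ht0.le ht1 (Nat.succ_ne_zero n)
  linarith

lemma tPochN_pos {t : ℝ} (ht0 : 0 < t) (ht1 : t < 1) (n : ℕ) : 0 < tPochN t n :=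
  Finset.prod_pos fun r _ => one_sub_pow_pos' ht0 ht1 r

lemma tPochN_anti {t : ℝ} (ht0 : 0 < t) (ht1 : t < 1) : Antitone (tPochN t) := by
  apply antitone_nat_of_succ_le
  intro n
  rw [tPochN_succ]
  have := tPochN_pos ht0 ht1 n
  have h2 : 0 < t^(n+1) := by positivity
  nlinarith

lemma tPoch_tendsto {t : ℝ} (ht0 : 0 < t) (ht1 : t < 1) :
    Filter.Tendsto (tPochN t) Filter.atTop (nhds (tPochInf t)) := by
  have hs : Summable fun r : ℕ => ‖-t^(r+1)‖ := by
    simp only [norm_neg]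
    have := (summable_geometric_of_lt_one ht0.le ht1).norm
    exact (summable_nat_add_iff 1).2 this
  have hm : Multipliable fun r : ℕ => (1 + -t^(r+1)) := multipliable_one_add_of_summable hs
  have := hm.hasProd.tendsto_prod_nat
  have e : tPochN t = fun n => ∏ i ∈ Finset.range n, (1 + -t ^ (i + 1)) := by
    funext n; simp [tPochN, sub_eq_add_neg]
  rw [e]
  simpa [tPochInf, sub_eq_add_neg] using this

lemma tPochInf_pos {t : ℝ} (ht0 : 0 < t) (ht1 : t < 1) : 0 < tPochInf t := by
  have hs : Summable fun r : ℕ => ‖-t^(r+1)‖ := by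
    simp only [norm_neg]
    have := (summable_geometric_of_lt_one ht0.le ht1).norm
    exact (summable_nat_add_iff 1).2 this
  have h1 : 0 ≤ tPochInf t :=
    ge_of_tendsto' (tPoch_tendsto ht0 ht1) fun n => (tPochN_pos ht0 ht1 n).le
  refine lt_of_le_of_ne h1 (Ne.symm ?_)
  have := tprod_one_add_ne_zero_of_summable (f := fun r : ℕ => -t^(r+1)) ?_ hs
  · simpa [tPochInf, sub_eq_add_neg] using this
  · intro i
    have := one_sub_pow_pos' ht0 ht1 i
    rw [← sub_eq_add_neg]
    exact this.ne'

lemma tPochInf_le {t : ℝ} (ht0 : 0 < t) (ht1 : t < 1) (n : ℕ) : tPochInf t ≤ tPochN t n :=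
  (tPochN_anti ht0 ht1).le_of_tendsto (tPoch_tendsto ht0 ht1) n

lemma gb_lt (t : ℝ) {k m : ℕ} (h : k < m) : tBinomN t k m = 0 := by
  simp [tBinomN, not_le.2 h]

lemma gb_add (t : ℝ) (m i : ℕ) :
    tBinomN t (m+i) m = tPochN t (m+i) / (tPochN t m * tPochN t i) := by
  simp [tBinomN]

lemma gb_symm (t : ℝ) (m i : ℕ) : tBinomN t (m+i) i = tBinomN t (m+i) m := by
  simp [tBinomN, mul_comm]

lemma gb_zero {t : ℝ} (ht0 : 0 < t) (ht1 : t < 1) (k : ℕ) : tBinomN t k 0 = 1 := by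
  have := (tPochN_pos ht0 ht1 k).ne'
  simp [tBinomN, tPochN_zero, this]

lemma gb_self {t : ℝ} (ht0 : 0 < t) (ht1 : t < 1) (k : ℕ) : tBinomN t k k = 1 := by
  have := (tPochN_pos ht0 ht1 k).ne'
  simp [tBinomN, tPochN_zero, this]

lemma gb_absorb {t : ℝ} (ht0 : 0 < t) (ht1 : t < 1) (k m : ℕ) :
    (1 - t^(m+1)) * tBinomN t k (m+1) = (1 - t^(k-m)) * tBinomN t k m := by
  rcases lt_trichotomy k m with h | h | h
  · rw [gb_lt t h, gb_lt t (by omega)]; simp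
  · subst h; rw [gb_lt t (by omega)]; simp
  · obtain ⟨i, rfl⟩ := Nat.exists_eq_add_of_lt h
    have e1 : m + i + 1 = (m+1) + i := by ring
    have e2 : m + i + 1 - m = i+1 := by omega
    rw [e2]
    conv_lhs => rw [e1, gb_add]
    rw [add_assoc m i 1, gb_add, tPochN_succ t m, tPochN_succ t i, show m + (i+1) = m+1+i by ring]
    have h1 := (tPochN_pos ht0 ht1 m).ne'
    have h2 := (tPochN_pos ht0 ht1 i).ne'
    have h3 := (one_sub_pow_pos' ht0 ht1 m).ne'
    have h4 := (one_sub_pow_pos' ht0 ht1 i).ne'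
    field_simp

lemma gb_pascal2 {t : ℝ} (ht0 : 0 < t) (ht1 : t < 1) (k m : ℕ) :
    tBinomN t (k+1) (m+1) = tBinomN t k m + t^(m+1) * tBinomN t k (m+1) := by
  rcases lt_trichotomy k m with h | h | h
  · rw [gb_lt t h, gb_lt t (by omega), gb_lt t (by omega)]; simp
  · subst h; rw [gb_lt t (show k < k+1 by omega), gb_self ht0 ht1, gb_self ht0 ht1]; simp
  · obtain ⟨i, rfl⟩ := Nat.exists_eq_add_of_lt h
    have h3 := (one_sub_pow_pos' ht0 ht1 m).ne'
    have hA := gb_absorb ht0 ht1 (m+i+1) m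
    have e2 : m + i + 1 - m = i+1 := by omega
    rw [e2] at hA
    have h4 : tBinomN t (m+i+1+1) (m+1) * (1 - t^(m+1))
        = tBinomN t (m+i+1) m * (1 - t^(m+i+1+1)) := by
      rw [show m+i+1+1 = (m+1) + (i+1) by ring, gb_add, add_assoc m i 1, gb_add,
        show m+1+(i+1) = m + (i+1) + 1 by ring, tPochN_succ t (m+(i+1)), tPochN_succ t m]
      have h1 := (tPochN_pos ht0 ht1 m).ne'
      have h2 := (tPochN_pos ht0 ht1 (i+1)).ne'
      field_simp
    apply mul_right_cancel₀ h3
    rw [h4]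
    have e : t^(m+i+1+1) = t^(m+1) * t^(i+1) := by ring
    rw [e]
    linear_combination (-t^(m+1)) * hA

lemma gb_pascal1 {t : ℝ} (ht0 : 0 < t) (ht1 : t < 1) (k m : ℕ) :
    tBinomN t (k+1) (m+1) = tBinomN t k (m+1) + t^(k-m) * tBinomN t k m := by
  have h1 := gb_pascal2 ht0 ht1 k m
  have h2 := gb_absorb ht0 ht1 k m
  linear_combination h1 - h2

lemma gb_nonneg {t : ℝ} (ht0 : 0 < t) (ht1 : t < 1) (k m : ℕ) : 0 ≤ tBinomN t k m := by
  unfold tBinomN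
  have := tPochN_pos ht0 ht1
  split_ifs
  · exact div_nonneg (this _).le (mul_pos (this _) (this _)).le
  · rfl

lemma gb_le {t : ℝ} (ht0 : 0 < t) (ht1 : t < 1) (k m : ℕ) :
    tBinomN t k m ≤ (tPochInf t)⁻¹ := by
  have h := tPochN_pos ht0 ht1
  have hP := tPochInf_pos ht0 ht1
  unfold tBinomN
  split_ifs with hk
  · rw [div_le_iff₀ (mul_pos (h _) (h _)), inv_mul_eq_div, le_div_iff₀ hP]
    exact mul_le_mul (tPochN_anti ht0 ht1 hk) (tPochInf_le ht0 ht1 _) hP.le (h _).le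
  · positivity

lemma choose_two_succ (n : ℕ) : (n+1).choose 2 = n.choose 2 + n := by
  rw [Nat.choose_succ_succ' n 1]; simp; ring

lemma qbinom {t : ℝ} (ht0 : 0 < t) (ht1 : t < 1) (k M : ℕ) :
    ∑ m ∈ Finset.range (M+1), (-1)^m * t^(m.choose 2) * tBinomN t (k+1) m
      = (-1)^M * t^((M+1).choose 2) * tBinomN t k M := by
  induction M with
  | zero => simp [gb_zero ht0 ht1]
  | succ M ih =>
    rw [Finset.sum_range_succ, ih, gb_pascal2 ht0 ht1, choose_two_succ (M+1)]
    ring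

noncomputable def aa (t : ℝ) (j : ℕ) : ℝ := (-1)^j / tPochN t j
noncomputable def bb (t : ℝ) (n k : ℕ) : ℝ := if k ≤ n then aa t (n-k) else 0

lemma aa_succ {t : ℝ} (ht0 : 0 < t) (ht1 : t < 1) (j : ℕ) :
    aa t j = -(1 - t^(j+1)) * aa t (j+1) := by
  unfold aa
  rw [tPochN_succ, pow_succ (-1:ℝ) j]
  have h2 := (tPochN_pos ht0 ht1 j).ne'
  have h3 := (one_sub_pow_pos' ht0 ht1 j).ne'
  rw [← div_div, eq_comm, mul_div_assoc', div_eq_iff h3]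
  ring

lemma bb_succ {t : ℝ} (ht0 : 0 < t) (ht1 : t < 1) (n k : ℕ) (h : k ≤ n) :
    bb t n (k+1) = -(1 - t^(n-k)) * bb t n k := by
  obtain ⟨i, rfl⟩ := Nat.exists_eq_add_of_le h
  rcases i with _ | i
  · simp [bb]
  · have e1 : k + (i+1) - (k+1) = i := by omega
    have e2 : k + (i+1) - k = i + 1 := by omega
    simp only [bb, e1, e2, h, if_true, show k+1 ≤ k+(i+1) by omega]
    exact aa_succ ht0 ht1 i

lemma bb_shift (t : ℝ) (n k : ℕ) : bb t (n+1) (k+1) = bb t n k := by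
  simp [bb]

lemma aa_abs {t : ℝ} (ht0 : 0 < t) (ht1 : t < 1) (j : ℕ) : |aa t j| ≤ (tPochInf t)⁻¹ := by
  have h := tPochN_pos ht0 ht1 j
  rw [aa, abs_div, abs_pow, abs_neg, abs_one, one_pow, abs_of_pos h, one_div]
  exact inv_anti₀ (tPochInf_pos ht0 ht1) (tPochInf_le ht0 ht1 j)

lemma bb_abs {t : ℝ} (ht0 : 0 < t) (ht1 : t < 1) (n k : ℕ) : |bb t n k| ≤ (tPochInf t)⁻¹ := by
  unfold bb
  split_ifs
  · exact aa_abs ht0 ht1 _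
  · have := tPochInf_pos ht0 ht1
    simp [this.le]

/-- key coefficient identity -/
lemma coeff_id {t : ℝ} (ht0 : 0 < t) (ht1 : t < 1) (n k m : ℕ) (h : k ≤ n) (hm : m ≤ n) :
    (t^(m+1) - 1) * (bb t n k * tBinomN t k (m+1)) + bb t n (k+1) * tBinomN t (k+1) (m+1)
      = bb t n (k+1) * tBinomN t k (m+1) - (1 - t^(n-m)) * (bb t n k * tBinomN t k m) := by
  rw [gb_pascal1 ht0 ht1 k m, bb_succ ht0 ht1 n k h]
  have hA := gb_absorb ht0 ht1 k m
  by_cases hk : m ≤ k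
  · have e : t^(n-m) = t^(n-k) * t^(k-m) := by rw [← pow_add]; congr 1; omega
    rw [e]
    linear_combination (-bb t n k) * hA
  · rw [gb_lt t (not_le.1 hk), gb_lt t (show k < m+1 by omega)]; simp

noncomputable def qf (k : ℕ) (v : ℝ) : ℝ := Real.exp (-v) * (v^k / (k.factorial : ℝ))
noncomputable def Qf (k : ℕ) (v : ℝ) : ℝ := qf k v + if 1 ≤ k then qf (k-1) v else 0
noncomputable def Qp (k : ℕ) (v : ℝ) : ℝ := if 1 ≤ k then Qf (k-1) v else 0

lemma qf_deriv_zero (v : ℝ) : HasDerivAt (qf 0) (-qf 0 v) v := by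
  have h1 : HasDerivAt (fun v : ℝ => Real.exp (-v)) (-Real.exp (-v)) v := by
    simpa using (hasDerivAt_neg v).exp
  have e : qf 0 = fun v : ℝ => Real.exp (-v) := by funext v; simp [qf]
  rw [e]; exact h1

lemma qf_deriv_succ (k : ℕ) (v : ℝ) : HasDerivAt (qf (k+1)) (-qf (k+1) v + qf k v) v := by
  have h1 : HasDerivAt (fun v : ℝ => Real.exp (-v)) (-Real.exp (-v)) v := by
    simpa using (hasDerivAt_neg v).exp
  have h2 : HasDerivAt (fun v : ℝ => v^(k+1) / ((k+1).factorial : ℝ))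
      (v^k / (k.factorial : ℝ)) v := by
    have := (hasDerivAt_pow (k+1) v).div_const ((k+1).factorial : ℝ)
    refine this.congr_deriv ?_
    rw [Nat.factorial_succ]
    have : (k.factorial : ℝ) ≠ 0 := by positivity
    rw [Nat.add_sub_cancel]
    push_cast
    field_simp
  exact (h1.fun_mul h2).congr_deriv (by simp [qf])

lemma Qf_deriv (k : ℕ) (v : ℝ) : HasDerivAt (Qf k) (-Qf k v + Qp k v) v := by
  rcases k with _ | _ | k
  · have e : Qf 0 = qf 0 := by funext v; simp [Qf]
    have := qf_deriv_zero v
    simpa [e, Qp] using this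
  · have e : Qf 1 = fun v => qf 1 v + qf 0 v := by funext v; simp [Qf]
    rw [zero_add, e]
    refine ((qf_deriv_succ 0 v).fun_add (qf_deriv_zero v)).congr_deriv ?_
    simp [Qf, Qp]
  · have e : Qf (k+1+1) = fun v => qf (k+1+1) v + qf (k+1) v := by funext v; simp [Qf]
    rw [e]
    refine ((qf_deriv_succ (k+1) v).fun_add (qf_deriv_succ k v)).congr_deriv ?_
    simp [Qf, Qp]
    ring

lemma qf_nonneg (k : ℕ) {v : ℝ} (hv : 0 ≤ v) : 0 ≤ qf k v := by
  unfold qf; positivity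

lemma qf_le_one (k : ℕ) {v : ℝ} (hv : 0 ≤ v) : qf k v ≤ 1 := by
  unfold qf
  have := Real.pow_div_factorial_le_exp v hv k
  rw [Real.exp_neg, inv_mul_le_iff₀ (Real.exp_pos v)]
  linarith

lemma qf_bound (k : ℕ) {v : ℝ} (hv : 0 ≤ v) : qf k v * (1 + v^2) ≤ 2 * (k+2)^2 := by
  have h1 := qf_le_one k hv
  have h2 := qf_le_one (k+2) hv
  have h3 : qf k v * v^2 = ((k+1)*(k+2)) * qf (k+2) v := by
    unfold qf
    rw [Nat.factorial_succ, Nat.factorial_succ]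
    push_cast
    have : (k.factorial : ℝ) ≠ 0 := by positivity
    field_simp
    ring
  have hk : (0:ℝ) ≤ k := by positivity
  have : ((k+1)*(k+2)) * qf (k+2) v ≤ ((k+1)*(k+2)) * 1 := by gcongr
  nlinarith

lemma Qf_nonneg (k : ℕ) {v : ℝ} (hv : 0 ≤ v) : 0 ≤ Qf k v := by
  unfold Qf
  have := qf_nonneg k hv
  have := qf_nonneg (k-1) hv
  split_ifs <;> linarith

lemma Qf_bound (k : ℕ) {v : ℝ} (hv : 0 ≤ v) : Qf k v ≤ 4 * (k+2)^2 / (1+v^2) := by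
  rw [le_div_iff₀ (by positivity)]
  unfold Qf
  have h1 := qf_bound k hv
  rcases k with _ | k
  · simp at *; linarith
  · have h2 := qf_bound k hv
    simp at *
    have : (0:ℝ) ≤ k := by positivity
    nlinarith

noncomputable def tau (t : ℝ) (m x : ℕ) (v : ℝ) : ℝ :=
  (-1)^m * t^((m+x).choose 2 + m.choose 2) *
    ∑ k ∈ Finset.range (m+x+1), bb t (m+x) k * tBinomN t k m * Qf k v

noncomputable def dtau (t : ℝ) (m x : ℕ) (v : ℝ) : ℝ :=
  (-1)^m * t^((m+x).choose 2 + m.choose 2) *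
    ∑ k ∈ Finset.range (m+x+1), bb t (m+x) k * tBinomN t k m * (-Qf k v + Qp k v)

lemma tau_deriv (t : ℝ) (m x : ℕ) (v : ℝ) : HasDerivAt (tau t m x) (dtau t m x v) v := by
  unfold tau dtau
  apply HasDerivAt.const_mul
  apply HasDerivAt.fun_sum
  intro k _
  exact (Qf_deriv k v).const_mul _

noncomputable def UU (t : ℝ) (m x : ℕ) (v : ℝ) : ℝ :=
  if 1 ≤ x then t^(x-1) * tau t m (x-1) v else 0
noncomputable def VV (t : ℝ) (m x : ℕ) (v : ℝ) : ℝ :=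
  if 1 ≤ m then t⁻¹ * (1 - t^(x+1)) * tau t (m-1) (x+1) v else 0

lemma UU_eq (t : ℝ) (m x : ℕ) (v : ℝ) :
    t^m * UU t m x v = (-1)^m * t^((m+x).choose 2 + m.choose 2) *
      ∑ k ∈ Finset.range (m+x+1), bb t (m+x) (k+1) * tBinomN t k m * Qf k v := by
  rcases x with _ | x
  · simp only [UU]
    rw [Finset.sum_eq_zero]
    · simp
    · intro k hk
      rcases lt_or_eq_of_le (Nat.lt_succ_iff.1 (Finset.mem_range.1 hk)) with h | h
      · rw [gb_lt t (by simpa using h)]; simp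
      · subst h; simp [bb]
  · simp only [UU, Nat.add_sub_cancel, Nat.le_add_left, if_true, tau]
    rw [← add_assoc, Finset.sum_range_succ _ (m+x+1)]
    simp only [bb_shift]
    rw [choose_two_succ]
    rw [show bb t (m+x) (m+x+1) = 0 by simp [bb]]
    ring

lemma VV_eq {t : ℝ} (ht0 : 0 < t) (ht1 : t < 1) (m x : ℕ) (v : ℝ) :
    t^(m+1) * VV t (m+1) x v = (-1)^(m+1) * t^((m+1+x).choose 2 + (m+1).choose 2) *
      ∑ k ∈ Finset.range (m+1+x+1),
        (-((1 - t^(x+1)) * (bb t (m+1+x) k * tBinomN t k m))) * Qf k v := by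
  simp only [VV, Nat.add_sub_cancel, Nat.le_add_left, if_true, tau]
  rw [choose_two_succ, show m + (x+1) = m+1+x by ring]
  simp only [neg_mul, Finset.sum_neg_distrib, mul_assoc, ← Finset.mul_sum]
  have := ht0.ne'
  field_simp
  ring

lemma ode_id {t : ℝ} (ht0 : 0 < t) (ht1 : t < 1) (m x : ℕ) (v : ℝ) :
    dtau t m x v / t^m = - tau t m x v + UU t m x v + VV t m x v := by
  have ht : t^m ≠ 0 := by positivity
  rw [div_eq_iff ht]
  have hQ : ∑ k ∈ Finset.range (m+x+1), bb t (m+x) k * tBinomN t k m * Qp k v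
      = ∑ k ∈ Finset.range (m+x+1), bb t (m+x) (k+1) * tBinomN t (k+1) m * Qf k v := by
    rw [Finset.sum_range_succ', Finset.sum_range_succ]
    simp [Qp, bb]
  have h1 : dtau t m x v = (-1)^m * t^((m+x).choose 2 + m.choose 2) *
    ∑ k ∈ Finset.range (m+x+1), (-(bb t (m+x) k * tBinomN t k m) +
      bb t (m+x) (k+1) * tBinomN t (k+1) m) * Qf k v := by
    simp only [dtau, mul_add, add_mul, Finset.sum_add_distrib, hQ]
    simp
  have h2 := UU_eq t m x v
  rw [h1]
  suffices h : (-1)^m * t^((m+x).choose 2 + m.choose 2) *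
    ∑ k ∈ Finset.range (m+x+1), (-(bb t (m+x) k * tBinomN t k m) +
      bb t (m+x) (k+1) * tBinomN t (k+1) m) * Qf k v + t^m * tau t m x v =
      t^m * UU t m x v + t^m * VV t m x v by linear_combination h
  rw [h2]
  rcases m with _ | m
  · simp only [VV, tau]
    simp [gb_zero ht0 ht1, add_mul, Finset.sum_add_distrib]
    ring
  · rw [VV_eq ht0 ht1]
    simp only [tau]
    rw [mul_left_comm, ← mul_add, ← mul_add, Finset.mul_sum, ← Finset.sum_add_distrib,
      ← Finset.sum_add_distrib]
    congr 1
    apply Finset.sum_congr rfl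
    intro k hk
    have := coeff_id ht0 ht1 (m+1+x) k m (Nat.lt_succ_iff.1 (Finset.mem_range.1 hk)) (by omega)
    rw [show m+1+x-m = x+1 by omega] at this
    linear_combination Qf k v * this

lemma choose_two_int (n : ℕ) : ((n.choose 2 : ℕ) : ℤ) * 2 = (n:ℤ) * ((n:ℤ) - 1) := by
  induction n with
  | zero => simp
  | succ n ih => rw [choose_two_succ]; push_cast; linarith

lemma Fterm_eq {t : ℝ} (ht0 : 0 < t) (ht1 : t < 1) (χ : ℝ) (L : ℤ) (x m : ℕ) :
    Fterm t χ L x m = tau t m x (χ * t^L / t^m) := by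
  have hv : χ * t^L / t^m = t^(L-(m:ℤ)) * χ := by
    rw [zpow_sub₀ ht0.ne', zpow_natCast]; ring
  rw [hv]
  have he : ((m : ℤ) ^ 2 + ((x : ℤ) - 1) * (m : ℤ) + (x : ℤ) * ((x : ℤ) - 1) / 2)
      = (((m+x).choose 2 + m.choose 2 : ℕ) : ℤ) := by
    rw [← choose_two_int x, Int.mul_ediv_cancel _ (by norm_num)]
    have h1 := choose_two_int (m+x)
    have h2 := choose_two_int m
    have h3 := choose_two_int x
    push_cast at *
    linarith
  unfold Fterm tau
  rw [he, zpow_natCast, add_assoc m x 1, Finset.sum_range_add _ m (x+1),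
    Finset.sum_eq_zero (s := Finset.range m), zero_add]
  · rw [mul_assoc (Real.exp _), mul_comm (Real.exp _), mul_assoc]
    congr 1
    rw [Finset.mul_sum]
    apply Finset.sum_congr rfl
    intro i hi
    have hi' : i ≤ x := Nat.lt_succ_iff.1 (Finset.mem_range.1 hi)
    rw [gb_symm, add_comm i m]
    simp only [bb, aa, Qf, qf, show m + i ≤ m + x by omega, if_true,
      show m + x - (m+i) = x - i by omega]
    rw [show -χ * t^(L-(m:ℤ)) = -(t^(L-(m:ℤ)) * χ) by ring]
    split_ifs <;> ring
  · intro k hk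
    rw [gb_lt t (Finset.mem_range.1 hk)]; simp

open MeasureTheory Set Filter Topology in
/-- one-component facts -/
lemma comp_y (g f : ℝ → ℝ) (hg : Continuous g) (hf : Continuous f) (h0 : g 0 = 0)
    (hd : ∀ u, 0 < u → HasDerivAt g (-g u + f u) u)
    (hfi : IntegrableOn (fun u => max (-(f u)) 0) (Ioi 0))
    (hgi : IntegrableOn (fun u => max (-(g u)) 0) (Ioi 0)) :
    (∫ u in Ioi (0:ℝ), max (-(g u)) 0) ≤ (∫ u in Ioi (0:ℝ), max (-(f u)) 0) ∧
    ((∫ u in Ioi (0:ℝ), max (-(f u)) 0) ≤ (∫ u in Ioi (0:ℝ), max (-(g u)) 0) →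
      (∃ u, 0 < u ∧ 0 < g u) → ∀ u, 0 < u → 0 ≤ g u) := by
  set fn : ℝ → ℝ := fun u => max (-(f u)) 0 with hfn
  have hfnc : Continuous fn := by fun_prop
  have hfn0 : ∀ u, 0 ≤ fn u := fun u => le_max_right _ _
  have hYc : Continuous fun s => Real.exp s * fn s := by fun_prop
  set Y : ℝ → ℝ := fun u => ∫ s in (0:ℝ)..u, Real.exp s * fn s with hY
  have hYd : ∀ u, HasDerivAt Y (Real.exp u * fn u) u := fun u =>
    intervalIntegral.integral_hasDerivAt_right (hYc.intervalIntegrable _ _)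
      (hYc.stronglyMeasurableAtFilter _ _) hYc.continuousAt
  have hYm : ∀ a b, 0 ≤ a → a ≤ b → Y a ≤ Y b := by
    intro a b ha hab
    have hm : Monotone Y := by
      apply monotone_of_deriv_nonneg (fun u => (hYd u).differentiableAt)
      intro u
      rw [(hYd u).deriv]
      exact mul_nonneg (Real.exp_pos u).le (hfn0 u)
    exact hm hab
  have hY00 : Y 0 = 0 := by simp [hY]
  set y : ℝ → ℝ := fun u => Real.exp (-u) * Y u with hy
  have hyd : ∀ u, HasDerivAt y (-y u + fn u) u := by
    intro u
    have h1 : HasDerivAt (fun v : ℝ => Real.exp (-v)) (-Real.exp (-u)) u := by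
      simpa using (hasDerivAt_neg u).exp
    refine (h1.fun_mul (hYd u)).congr_deriv ?_
    simp only [hy]
    rw [← mul_assoc, ← Real.exp_add]
    simp
  have hyc : Continuous y := continuous_iff_continuousAt.2 fun u => (hyd u).continuousAt
  have hy0 : ∀ u, 0 ≤ u → 0 ≤ y u := fun u hu =>
    mul_nonneg (Real.exp_pos _).le (hY00 ▸ hYm 0 u le_rfl hu)
  have hy00 : y 0 = 0 := by simp [hy, hY00]
  -- z = g + y, exp u * z is monotone
  have hz : ∀ a b, 0 ≤ a → a ≤ b → Real.exp a * (g a + y a) ≤ Real.exp b * (g b + y b) := by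
    have hm : MonotoneOn (fun u => Real.exp u * (g u + y u)) (Ici 0) := by
      apply monotoneOn_of_deriv_nonneg (convex_Ici 0)
      · fun_prop
      · intro u hu
        rw [interior_Ici] at hu
        exact ((Real.hasDerivAt_exp u).mul ((hd u hu).add (hyd u))).differentiableAt.differentiableWithinAt
      · intro u hu
        rw [interior_Ici] at hu
        rw [((Real.hasDerivAt_exp u).fun_mul ((hd u hu).fun_add (hyd u))).deriv]
        have h3 : 0 ≤ f u + fn u := by
          have := le_max_left (-(f u)) 0
          simp only [hfn]; linarith
        have := mul_nonneg (Real.exp_pos u).le h3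
        linarith
    intro a b ha hab
    exact hm ha (ha.trans hab) hab
  have hz0 : ∀ u, 0 ≤ u → 0 ≤ g u + y u := by
    intro u hu
    have := hz 0 u le_rfl hu
    rw [h0, hy00, add_zero, mul_zero] at this
    exact nonneg_of_mul_nonneg_right this (Real.exp_pos u)
  have hle : ∀ u, 0 ≤ u → max (-(g u)) 0 ≤ y u := fun u hu =>
    max_le (by linarith [hz0 u hu]) (hy0 u hu)
  have hint : ∀ R, 0 ≤ R → ∫ u in (0:ℝ)..R, y u ≤ ∫ u in Ioi (0:ℝ), fn u := by
    intro R hR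
    have h1 : ∫ u in (0:ℝ)..R, (-y u + fn u) = y R - y 0 :=
      intervalIntegral.integral_eq_sub_of_hasDerivAt (fun u _ => hyd u)
        ((hyc.neg.add hfnc).intervalIntegrable _ _)
    rw [intervalIntegral.integral_add (hyc.fun_neg.intervalIntegrable _ _)
      (hfnc.intervalIntegrable _ _), intervalIntegral.integral_neg, hy00] at h1
    have h2 : ∫ u in (0:ℝ)..R, fn u ≤ ∫ u in Ioi (0:ℝ), fn u := by
      rw [intervalIntegral.integral_of_le hR]
      exact setIntegral_mono_set hfi (Eventually.of_forall hfn0)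
        (HasSubset.Subset.eventuallyLE Ioc_subset_Ioi_self)
    have := hy0 R hR
    linarith
  have hyi : IntegrableOn y (Ioi 0) := by
    apply integrableOn_Ioi_of_intervalIntegral_norm_bounded (∫ u in Ioi (0:ℝ), fn u) 0
      (fun i : ℝ => (hyc.integrableOn_Ioc)) tendsto_id
    filter_upwards [eventually_ge_atTop 0] with R hR
    refine le_trans (le_of_eq ?_) (hint R hR)
    apply intervalIntegral.integral_congr
    intro u hu
    rw [id, uIcc_of_le hR] at hu
    simp [abs_of_nonneg (hy0 u hu.1)]
  have hyI : ∫ u in Ioi (0:ℝ), y u ≤ ∫ u in Ioi (0:ℝ), fn u := by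
    refine le_of_tendsto (intervalIntegral_tendsto_integral_Ioi 0 hyi tendsto_id) ?_
    filter_upwards [eventually_ge_atTop 0] with R hR using hint R hR
  have hgy : (∫ u in Ioi (0:ℝ), max (-(g u)) 0) ≤ ∫ u in Ioi (0:ℝ), y u :=
    setIntegral_mono_on hgi hyi measurableSet_Ioi fun u hu => hle u (le_of_lt hu)
  refine ⟨hgy.trans hyI, ?_⟩
  rintro hrev ⟨u0, hu0, hgu0⟩
  have heq : ∫ u in Ioi (0:ℝ), (y u - max (-(g u)) 0) = 0 := by
    rw [integral_sub hyi hgi]; linarith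
  have hae : (fun u => y u - max (-(g u)) 0) =ᵐ[volume.restrict (Ioi 0)] 0 := by
    rw [setIntegral_eq_zero_iff_of_nonneg_ae] at heq
    · exact heq
    · filter_upwards [ae_restrict_mem measurableSet_Ioi] with u hu
      have := hle u (le_of_lt hu)
      simp only [Pi.zero_apply]; linarith
    · exact hyi.sub hgi
  have hEq : EqOn (fun u => y u - max (-(g u)) 0) 0 (Ioi 0) :=
    Measure.eqOn_open_of_ae_eq hae isOpen_Ioi (by fun_prop) (by fun_prop)
  have hEq' : ∀ u, 0 < u → y u = max (-(g u)) 0 := by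
    intro u hu
    have := hEq hu
    simp at this
    linarith
  have hyz : ∀ u, u0 ≤ u → y u = 0 := by
    intro u hu
    have h1 := hz u0 u hu0.le hu
    have h2 : 0 < Real.exp u0 * (g u0 + y u0) :=
      mul_pos (Real.exp_pos _) (by linarith [hy0 u0 hu0.le])
    have h3 : 0 < g u + y u := pos_of_mul_pos_right (h2.trans_le h1) (Real.exp_pos u).le
    have h4 := hEq' u (hu0.trans_le hu)
    rcases max_choice (-(g u)) 0 with h | h <;> linarith
  intro u hu
  have h5 : Y u ≤ Y (max u u0) := hYm _ _ hu.le (le_max_left _ _)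
  have h6 : Y (max u u0) = 0 := by
    have := hyz _ (le_max_right u u0)
    simp only [hy] at this
    exact (mul_eq_zero.1 this).resolve_left (Real.exp_pos _).ne'
  have h7 : y u ≤ 0 := by
    simp only [hy]
    exact mul_nonpos_of_nonneg_of_nonpos (Real.exp_pos _).le (by linarith)
  have h8 := hle u hu.le
  have h9 := le_max_left (-(g u)) 0
  linarith

open MeasureTheory Set Filter Topology in
lemma pos_abs {t : ℝ} (ht0 : 0 < t) (ht1 : t < 1) (g : ℕ → ℝ → ℝ) (hc : ∀ x, Continuous (g x))
    (C ρ : ℝ) (hρ0 : 0 < ρ) (hρ1 : ρ < 1)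
    (hb : ∀ x u, 0 ≤ u → |g x u| ≤ C * ρ^x / (1+u^2))
    (h0 : ∀ x, g x 0 = 0)
    (hd : ∀ x u, 0 < u → HasDerivAt (g x) (-g x u + ((if 1 ≤ x then t^(x-1) * g (x-1) u else 0) +
      (1 - t^(x+1)) * (t⁻¹ * g (x+1) (t⁻¹ * u)))) u)
    (hpos : ∀ x, ∃ u, 0 < u ∧ 0 < g x u) : ∀ x u, 0 < u → 0 ≤ g x u := by
  set n : ℕ → ℝ → ℝ := fun x u => max (-(g x u)) 0 with hn
  have hnc : ∀ x, Continuous (n x) := fun x => by have := hc x; fun_prop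
  have hn0 : ∀ x u, 0 ≤ n x u := fun x u => le_max_right _ _
  have hni : ∀ x, IntegrableOn (n x) (Ioi 0) := by
    intro x
    have h1 : IntegrableOn (fun u : ℝ => C * ρ^x * (1+u^2)⁻¹) (Ioi 0) :=
      (integrable_inv_one_add_sq.const_mul _).integrableOn
    refine Integrable.mono' h1 (hnc x).aestronglyMeasurable ?_
    filter_upwards [ae_restrict_mem measurableSet_Ioi] with u hu
    rw [Real.norm_of_nonneg (hn0 x u)]
    have h2 := hb x u (le_of_lt hu)
    have h3 := neg_le_abs (g x u)
    exact max_le (h3.trans h2) ((abs_nonneg _).trans h2)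
  set N : ℕ → ℝ := fun x => ∫ u in Ioi (0:ℝ), n x u with hN
  have hN0 : ∀ x, 0 ≤ N x := fun x => integral_nonneg (hn0 x)
  have hNs : Summable N := by
    have hs := (summable_geometric_of_lt_one hρ0.le hρ1).mul_left (∫ u in Ioi (0:ℝ), C * (1+u^2)⁻¹)
    refine Summable.of_nonneg_of_le hN0 (fun x => ?_) hs
    rw [← integral_mul_const]
    have h1 : IntegrableOn (fun u : ℝ => C * (1+u^2)⁻¹ * ρ^x) (Ioi 0) :=
      ((integrable_inv_one_add_sq.const_mul C).mul_const (ρ^x)).integrableOn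
    refine setIntegral_mono_on (hni x) h1 measurableSet_Ioi ?_
    · intro u hu
      have h2 := hb x u (le_of_lt hu)
      have h3 := neg_le_abs (g x u)
      refine (max_le (h3.trans h2) ((abs_nonneg _).trans h2)).trans (le_of_eq ?_)
      rw [div_eq_mul_inv]; ring
  set f : ℕ → ℝ → ℝ := fun x u => (if 1 ≤ x then t^(x-1) * g (x-1) u else 0) +
      (1 - t^(x+1)) * (t⁻¹ * g (x+1) (t⁻¹ * u)) with hf
  have hfc : ∀ x, Continuous (f x) := by
    intro x
    have := hc (x+1)
    have := hc (x-1)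
    simp only [hf]
    split_ifs <;> fun_prop
  set B : ℕ → ℝ → ℝ := fun x u => (if 1 ≤ x then t^(x-1) * n (x-1) u else 0) +
      (1 - t^(x+1)) * (t⁻¹ * n (x+1) (t⁻¹ * u)) with hB
  have ht' : 0 < t⁻¹ := by positivity
  have hsc : ∀ x, IntegrableOn (fun u => n x (t⁻¹ * u)) (Ioi 0) := by
    intro x
    rw [integrableOn_Ioi_comp_mul_left_iff _ _ ht']
    simpa using hni x
  have hB1 : ∀ x, IntegrableOn (fun u => if 1 ≤ x then t^(x-1) * n (x-1) u else 0) (Ioi 0) := by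
    intro x
    split_ifs
    · exact (hni (x-1)).const_mul _
    · exact integrableOn_zero
  have hB2 : ∀ x, IntegrableOn (fun u => (1 - t^(x+1)) * (t⁻¹ * n (x+1) (t⁻¹ * u))) (Ioi 0) :=
    fun x => ((hsc (x+1)).const_mul _).const_mul _
  have hBi : ∀ x, IntegrableOn (B x) (Ioi 0) := fun x => (hB1 x).add (hB2 x)
  have hBI : ∀ x, ∫ u in Ioi (0:ℝ), B x u =
      (if 1 ≤ x then t^(x-1) * N (x-1) else 0) + (1 - t^(x+1)) * N (x+1) := by
    intro x
    simp only [hB]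
    rw [integral_add (hB1 x) (hB2 x), integral_const_mul, integral_const_mul,
      integral_comp_mul_left_Ioi (n (x+1)) 0 ht']
    congr 1
    · split_ifs
      · rw [integral_const_mul]
      · simp
    · simp [hN, ht0.ne']
  have hfB : ∀ x u, max (-(f x u)) 0 ≤ B x u := by
    intro x u
    have h1 := (one_sub_pow_pos' ht0 ht1 x).le
    have k : ∀ x u, -(g x u) ≤ n x u := fun x u => le_max_left _ _
    apply max_le
    · simp only [hf, hB]
      have e1 : (1 - t^(x+1)) * (t⁻¹ * -(g (x+1) (t⁻¹ * u))) ≤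
        (1 - t^(x+1)) * (t⁻¹ * n (x+1) (t⁻¹ * u)) := by gcongr; exact k _ _
      split_ifs
      · have e2 : t^(x-1) * -(g (x-1) u) ≤ t^(x-1) * n (x-1) u := by gcongr; exact k _ _
        linarith
      · linarith
    · simp only [hB]
      have e1 := mul_nonneg h1 (mul_nonneg ht'.le (hn0 (x+1) (t⁻¹ * u)))
      split_ifs
      · have e2 := mul_nonneg (pow_nonneg ht0.le (x-1)) (hn0 (x-1) u)
        linarith
      · linarith
  have hfi : ∀ x, IntegrableOn (fun u => max (-(f x u)) 0) (Ioi 0) := by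
    intro x
    have := hfc x
    refine Integrable.mono' (hBi x) (by fun_prop) (Eventually.of_forall fun u => ?_)
    rw [Real.norm_of_nonneg (le_max_right _ _)]
    exact hfB x u
  have hfI : ∀ x, ∫ u in Ioi (0:ℝ), max (-(f x u)) 0 ≤
      (if 1 ≤ x then t^(x-1) * N (x-1) else 0) + (1 - t^(x+1)) * N (x+1) := by
    intro x
    rw [← hBI]
    exact integral_mono (hfi x) (hBi x) (hfB x)
  have key := fun x => comp_y (g x) (f x) (hc x) (hfc x) (h0 x) (hd x) (hfi x) (hni x)
  -- summation
  set S1 : ℕ → ℝ := fun x => if 1 ≤ x then t^(x-1) * N (x-1) else 0 with hS1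
  set S2 : ℕ → ℝ := fun x => (1 - t^(x+1)) * N (x+1) with hS2
  have hp : ∀ x : ℕ, 0 ≤ t^x ∧ t^x ≤ 1 := fun x => ⟨by positivity, pow_le_one₀ ht0.le ht1.le⟩
  have s1 : Summable fun x => t^x * N x :=
    Summable.of_nonneg_of_le (fun x => mul_nonneg (hp x).1 (hN0 x))
      (fun x => mul_le_of_le_one_left (hN0 x) (hp x).2) hNs
  have s2 : Summable fun x => (1 - t^x) * N x := by
    have := hNs.sub s1
    refine this.congr fun x => by ring
  have hS1s : HasSum S1 (∑' x, t^x * N x) := by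
    rw [← hasSum_nat_add_iff' 1]
    simpa [hS1] using s1.hasSum
  have hS2s : HasSum S2 (∑' x, (1 - t^x) * N x) := by
    have := (hasSum_nat_add_iff' (f := fun x => (1 - t^x) * N x) 1).2 s2.hasSum
    simpa [hS2] using this
  have hsum : HasSum (fun x => S1 x + S2 x) (∑' x, N x) := by
    have := hS1s.add hS2s
    rwa [← s1.tsum_add s2, show (fun x => t^x * N x + (1 - t^x) * N x) = N from
      funext fun x => by ring] at this
  have hle : ∀ x, N x ≤ S1 x + S2 x := fun x => (key x).1.trans (hfI x)
  have hzero : ∀ x, S1 x + S2 x = N x := by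
    have hs0 : HasSum (fun x => S1 x + S2 x - N x) 0 := by
      simpa using hsum.sub hNs.hasSum
    have := (hasSum_zero_iff_of_nonneg (fun x => sub_nonneg.2 (hle x))).1 hs0
    intro x
    have := congrFun this x
    simp at this
    linarith
  intro x
  exact (key x).2 ((hfI x).trans (le_of_eq (hzero x))) (hpos x)

lemma tchoose_bound {t σ : ℝ} (ht0 : 0 < t) (ht1 : t < 1) (hσ0 : 0 < σ) (hσ1 : σ ≤ 1) :
    ∃ C : ℝ, 0 ≤ C ∧ ∀ n : ℕ, t^(n.choose 2) ≤ C * σ^n := by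
  obtain ⟨N, hN⟩ := exists_pow_lt_of_lt_one hσ0 ht1
  refine ⟨(σ^N)⁻¹, by positivity, fun n => ?_⟩
  rw [inv_mul_eq_div, le_div_iff₀ (by positivity)]
  induction n with
  | zero => simpa using pow_le_one₀ hσ0.le hσ1
  | succ n ih =>
    by_cases h : n + 1 ≤ N
    · calc t^((n+1).choose 2) * σ^N ≤ 1 * σ^(n+1) := by
            apply mul_le_mul (pow_le_one₀ ht0.le ht1.le) (pow_le_pow_of_le_one hσ0.le hσ1 h)
              (by positivity) (by norm_num)
        _ = _ := one_mul _
    · have h1 : t^n ≤ σ := (pow_le_pow_of_le_one ht0.le ht1.le (by omega)).trans hN.le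
      rw [choose_two_succ, pow_add, pow_succ σ n]
      calc t^(n.choose 2) * t^n * σ^N = (t^(n.choose 2) * σ^N) * t^n := by ring
        _ ≤ σ^n * σ := mul_le_mul ih h1 (by positivity) (by positivity)

lemma tau_bound_gen {t ρ K : ℝ} (ht0 : 0 < t) (ht1 : t < 1) (hρ0 : 0 < ρ) (hρ1 : ρ < 1)
    (hK : 1 ≤ K) : ∃ C : ℝ, 0 ≤ C ∧ ∀ m x v w, 0 ≤ w → (∀ k, |Qf k v| ≤ K^k * w) →
      |tau t m x v| ≤ C * ρ^(m+x) * w := by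
  have hK0 : 0 < K := by linarith
  obtain ⟨C, hC, h⟩ := tchoose_bound (t := t) (σ := ρ / (2*K)) ht0 ht1 (by positivity)
    (by rw [div_le_one (by positivity)]; linarith)
  have hP := tPochInf_pos ht0 ht1
  refine ⟨C * ((tPochInf t)⁻¹ * (tPochInf t)⁻¹), by positivity, ?_⟩
  intro m x v w hw hQ
  have h2 : ∀ k ∈ Finset.range (m+x+1), |bb t (m+x) k * tBinomN t k m * Qf k v| ≤
      (tPochInf t)⁻¹ * (tPochInf t)⁻¹ * (K^(m+x) * w) := by
    intro k hk
    rw [abs_mul, abs_mul, abs_of_nonneg (gb_nonneg ht0 ht1 k m)]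
    have h3 : K^k ≤ K^(m+x) := pow_le_pow_right₀ hK (Nat.lt_succ_iff.1 (Finset.mem_range.1 hk))
    have h4 : |Qf k v| ≤ K^(m+x) * w := (hQ k).trans (by gcongr)
    have := bb_abs ht0 ht1 (m+x) k
    have := gb_le ht0 ht1 k m
    have := gb_nonneg ht0 ht1 k m
    gcongr
  have h3 := (Finset.abs_sum_le_sum_abs _ _).trans (Finset.sum_le_sum h2)
  rw [Finset.sum_const, Finset.card_range, nsmul_eq_mul] at h3
  unfold tau
  rw [abs_mul, abs_mul, abs_pow, abs_neg, abs_one, one_pow, one_mul,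
    abs_of_pos (by positivity), pow_add]
  have h4 : t^(m.choose 2) ≤ 1 := pow_le_one₀ ht0.le ht1.le
  have h5 := h (m+x)
  have h6 : (((m+x+1 : ℕ)) : ℝ) ≤ 2^(m+x) := by
    exact_mod_cast Nat.lt_two_pow_self
  calc _ ≤ (C * (ρ/(2*K))^(m+x) * 1) * (2^(m+x) * ((tPochInf t)⁻¹ * (tPochInf t)⁻¹ * (K^(m+x) * w))) := by
        apply mul_le_mul (mul_le_mul h5 h4 (by positivity) (by positivity))
          (h3.trans (by gcongr)) (abs_nonneg _) (by positivity)
    _ = C * ((tPochInf t)⁻¹ * (tPochInf t)⁻¹) * ρ^(m+x) * w *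
        ((1/(2*K))^(m+x) * 2^(m+x) * K^(m+x)) := by
          rw [div_eq_mul_one_div ρ, mul_pow]; ring
    _ = _ := by
          rw [← mul_pow, ← mul_pow, show 1/(2*K)*2*K = 1 by field_simp, one_pow, mul_one]

lemma tau_bound {t ρ : ℝ} (ht0 : 0 < t) (ht1 : t < 1) (hρ0 : 0 < ρ) (hρ1 : ρ < 1) :
    ∃ C : ℝ, 0 ≤ C ∧ ∀ m x v, 0 ≤ v → |tau t m x v| ≤ C * ρ^(m+x) / (1+v^2) := by
  obtain ⟨C, hC, h⟩ := tau_bound_gen (K := 4) ht0 ht1 hρ0 hρ1 (by norm_num)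
  refine ⟨C * 16, by positivity, fun m x v hv => ?_⟩
  refine (h m x v (16/(1+v^2)) (by positivity) fun k => ?_).trans (le_of_eq (by ring))
  rw [abs_of_nonneg (Qf_nonneg k hv)]
  refine (Qf_bound k hv).trans ?_
  rw [mul_div_assoc']
  have h1 : (k:ℝ) + 2 ≤ 2 * 2^k := by
    have : ((k+1:ℕ):ℝ) ≤ 2^k := by exact_mod_cast Nat.lt_two_pow_self
    have h2 : (1:ℝ) ≤ 2^k := one_le_pow₀ (by norm_num)
    push_cast at this
    linarith
  have h2 : ((k:ℝ)+2)^2 ≤ (2*2^k)^2 := by gcongr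
  have h3 : (4:ℝ)^k = (2^k)^2 := by rw [← pow_mul, mul_comm, pow_mul]; norm_num
  apply div_le_div_of_nonneg_right _ (by positivity)
  rw [h3]
  nlinarith

lemma tau_cont (t : ℝ) (m x : ℕ) : Continuous (tau t m x) :=
  continuous_iff_continuousAt.2 fun v => (tau_deriv t m x v).continuousAt

lemma tau_bound' {t ρ : ℝ} (ht0 : 0 < t) (ht1 : t < 1) (hρ0 : 0 < ρ) (hρ1 : ρ < 1) :
    ∃ C : ℝ, 0 ≤ C ∧ (∀ m x v, 0 ≤ v → |tau t m x v| ≤ C * ρ^(m+x) / (1+v^2)) ∧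
     (∀ m x v, 0 ≤ v → |tau t m x v| ≤ C * ρ^(m+x)) ∧
     (∀ m x u, 0 ≤ u → |tau t m x (u/t^m)| ≤ C * ρ^(m+x) / (1+u^2)) := by
  obtain ⟨C, hC, h⟩ := tau_bound ht0 ht1 hρ0 hρ1
  refine ⟨C, hC, h, fun m x v hv => (h m x v hv).trans ?_, fun m x u hu =>
    (h m x _ (by positivity)).trans ?_⟩
  · exact div_le_self (by positivity) (by nlinarith)
  · have : u ≤ u / t^m := by
      rw [le_div_iff₀ (by positivity)]
      exact mul_le_of_le_one_right hu (pow_le_one₀ ht0.le ht1.le)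
    gcongr

noncomputable def GG (t : ℝ) (x : ℕ) (u : ℝ) : ℝ := ∑' m : ℕ, tau t m x (u/t^m)

lemma GG_summable {t : ℝ} (ht0 : 0 < t) (ht1 : t < 1) (x : ℕ) {u : ℝ} (hu : 0 ≤ u) :
    Summable fun m : ℕ => |tau t m x (u/t^m)| := by
  obtain ⟨C, hC, -, -, h⟩ := tau_bound' (ρ := 1/2) ht0 ht1 (by norm_num) (by norm_num)
  have hs : Summable fun m : ℕ => (C * (1/2)^x / (1+u^2)) * (1/2:ℝ)^m :=
    (summable_geometric_of_lt_one (by norm_num) (by norm_num)).mul_left _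
  refine Summable.of_nonneg_of_le (fun _ => abs_nonneg _) (fun m => (h m x u hu).trans ?_) hs
  rw [pow_add]
  apply le_of_eq; ring

lemma GG_bound {t : ℝ} (ht0 : 0 < t) (ht1 : t < 1) :
    ∃ C : ℝ, 0 ≤ C ∧ ∀ x u, 0 ≤ u → |GG t x u| ≤ C * (1/2)^x / (1+u^2) := by
  obtain ⟨C, hC, -, -, h⟩ := tau_bound' (ρ := 1/2) ht0 ht1 (by norm_num) (by norm_num)
  refine ⟨C*2, by positivity, fun x u hu => ?_⟩
  have hs : HasSum (fun m : ℕ => (C * (1/2)^x / (1+u^2)) * (1/2:ℝ)^m) (C * (1/2)^x / (1+u^2) * 2) :=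
    hasSum_geometric_two.mul_left _
  have := tsum_of_norm_bounded hs (f := fun m => tau t m x (u/t^m)) fun m => by
    refine (h m x u hu).trans (le_of_eq ?_)
    rw [pow_add]; ring
  refine this.trans (le_of_eq (by ring))

lemma Qf_at_zero (k : ℕ) : Qf k 0 = if k ≤ 1 then 1 else 0 := by
  rcases k with _ | _ | k
  · simp [Qf, qf]
  · simp [Qf, qf]
  · simp [Qf, qf]

lemma tau_at_zero (t : ℝ) (m x : ℕ) : tau t m x 0 = (-1)^m * t^((m+x).choose 2 + m.choose 2) *
    (bb t (m+x) 0 * tBinomN t 0 m + bb t (m+x) 1 * tBinomN t 1 m) := by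
  unfold tau
  congr 1
  generalize m + x = n
  rcases n with _ | n
  · simp [Qf_at_zero, bb]
  · rw [Finset.sum_range_succ', Finset.sum_range_succ']
    simp [Qf_at_zero]
    ring

lemma tau_zero_ge (t : ℝ) (m x : ℕ) (h : 2 ≤ m) : tau t m x 0 = 0 := by
  rw [tau_at_zero, gb_lt t (by omega : 0 < m), gb_lt t (by omega : 1 < m)]; simp

lemma tau_zero_one {t : ℝ} (ht0 : 0 < t) (ht1 : t < 1) (x : ℕ) :
    tau t 1 x 0 = -(t^((x+1).choose 2) * aa t x) := by
  rw [tau_at_zero, gb_lt t (by omega : 0 < 1), gb_self ht0 ht1, add_comm 1 x]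
  simp [bb]

lemma GG_zero {t : ℝ} (ht0 : 0 < t) (ht1 : t < 1) (x : ℕ) : GG t x 0 = 0 := by
  unfold GG
  simp only [zero_div]
  rw [tsum_eq_sum (s := Finset.range 2)]
  · rw [Finset.sum_range_succ, Finset.sum_range_one, tau_zero_one ht0 ht1, tau_at_zero,
      gb_zero ht0 ht1, gb_zero ht0 ht1, zero_add, bb_succ ht0 ht1 x 0 (Nat.zero_le _),
      choose_two_succ]
    simp [bb]
    ring
  · intro m hm
    exact tau_zero_ge t m x (by simp at hm; omega)

lemma GG_deriv {t : ℝ} (ht0 : 0 < t) (ht1 : t < 1) (x : ℕ) (u : ℝ) (hu : 0 < u) :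
    HasDerivAt (GG t x) (-GG t x u + ((if 1 ≤ x then t^(x-1) * GG t (x-1) u else 0) +
      (1 - t^(x+1)) * (t⁻¹ * GG t (x+1) (t⁻¹ * u)))) u := by
  obtain ⟨C, hC, -, h, -⟩ := tau_bound' (ρ := 1/2) ht0 ht1 (by norm_num) (by norm_num)
  have hder : ∀ (m : ℕ) (y : ℝ), HasDerivAt (fun u => tau t m x (u/t^m))
      (-tau t m x (y/t^m) + UU t m x (y/t^m) + VV t m x (y/t^m)) y := by
    intro m y
    have h1 := (tau_deriv t m x (y/t^m)).comp y ((hasDerivAt_id y).div_const (t^m))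
    refine h1.congr_deriv ?_
    have h2 := ode_id ht0 ht1 m x (y/t^m)
    rw [← h2]
    ring
  have hp1 : ∀ k : ℕ, 0 ≤ t^k ∧ t^k ≤ 1 := fun k =>
    ⟨by positivity, pow_le_one₀ ht0.le ht1.le⟩
  have hti : 0 < t⁻¹ := by positivity
  have hU : ∀ (m : ℕ) (y : ℝ), 0 ≤ y → |UU t m x y| ≤ 2 * C * (1/2)^m := by
    intro m y hy
    unfold UU
    split_ifs
    · rw [abs_mul, abs_of_nonneg (hp1 _).1]
      calc _ ≤ 1 * (C * (1/2)^(m+(x-1))) := mul_le_mul (hp1 _).2 (h _ _ _ hy) (abs_nonneg _) (by norm_num)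
        _ ≤ 2 * C * (1/2)^m := by
          rw [pow_add]
          have e1 : (1/2:ℝ)^(x-1) ≤ 1 := pow_le_one₀ (by norm_num) (by norm_num)
          have e2 : (0:ℝ) ≤ C * (1/2)^m := by positivity
          nlinarith
    · simp; positivity
  have hV : ∀ (m : ℕ) (y : ℝ), 0 ≤ y → |VV t m x y| ≤ t⁻¹ * C * (1/2)^m := by
    intro m y hy
    unfold VV
    split_ifs with hm
    · have e0 := one_sub_pow_pos' ht0 ht1 x
      rw [abs_mul, abs_of_nonneg (by positivity)]
      have e3 : t⁻¹ * (1 - t^(x+1)) ≤ t⁻¹ * 1 := by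
        have := (hp1 (x+1)).1
        gcongr; linarith
      calc _ ≤ t⁻¹ * 1 * (C * (1/2)^((m-1)+(x+1))) :=
            mul_le_mul e3 (h _ _ _ hy) (abs_nonneg _) (by positivity)
        _ ≤ _ := by
          rw [show m-1+(x+1) = m + x by omega, pow_add]
          have e1 : (1/2:ℝ)^x ≤ 1 := pow_le_one₀ (by norm_num) (by norm_num)
          have e2 : (0:ℝ) ≤ t⁻¹ * C * (1/2)^m := by positivity
          nlinarith
    · simp; positivity
  have hT : ∀ (m : ℕ) (y : ℝ), 0 ≤ y → |tau t m x y| ≤ C * (1/2)^m := by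
    intro m y hy
    refine (h m x y hy).trans ?_
    rw [pow_add]
    have e1 : (1/2:ℝ)^x ≤ 1 := pow_le_one₀ (by norm_num) (by norm_num)
    have e2 : (0:ℝ) ≤ C * (1/2)^m := by positivity
    nlinarith
  have hgeo : ∀ D : ℝ, Summable fun m : ℕ => D * (1/2:ℝ)^m := fun D =>
    (summable_geometric_of_lt_one (by norm_num) (by norm_num)).mul_left _
  have hmain := hasDerivAt_tsum_of_isPreconnected (hgeo (C + 2*C + t⁻¹*C)) (isOpen_Ioi (a := (0:ℝ)))
    isPreconnected_Ioi (fun m y _ => hder m y) (fun m y hy => by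
      have hy' : 0 ≤ y/t^m := div_nonneg (le_of_lt hy) (by positivity)
      rw [Real.norm_eq_abs]
      refine (abs_add_three _ _ _).trans ?_
      rw [abs_neg]
      have := hT m _ hy'
      have := hU m _ hy'
      have := hV m _ hy'
      linarith) (y₀ := u) hu (GG_summable ht0 ht1 x hu.le).of_abs hu
  refine hmain.congr_deriv ?_
  have hu' : ∀ m : ℕ, 0 ≤ u/t^m := fun m => by positivity
  have sT : Summable fun m : ℕ => tau t m x (u/t^m) := (GG_summable ht0 ht1 x hu.le).of_abs
  have sU : Summable fun m : ℕ => UU t m x (u/t^m) :=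
    Summable.of_norm_bounded (hgeo (2*C)) fun m => hU m _ (hu' m)
  have sV : Summable fun m : ℕ => VV t m x (u/t^m) :=
    Summable.of_norm_bounded (hgeo (t⁻¹*C)) fun m => hV m _ (hu' m)
  rw [(sT.neg.add sU).tsum_add sV, sT.neg.tsum_add sU, tsum_neg, add_assoc]
  congr 2
  · unfold UU GG
    split_ifs
    · rw [tsum_mul_left]
    · simp
  · rw [sV.tsum_eq_zero_add]
    simp only [VV, GG]
    simp only [Nat.add_sub_cancel, Nat.le_add_left, if_true, tsum_mul_left]
    rw [if_neg (by norm_num), zero_add, mul_left_comm, mul_assoc]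
    congr 2
    rw [tsum_congr]
    · intro m
      congr 1
      rw [pow_succ]; field_simp

lemma GG_cont {t : ℝ} (ht0 : 0 < t) (ht1 : t < 1) (x : ℕ) :
    Continuous fun u => GG t x (max u 0) := by
  obtain ⟨C, hC, -, h, -⟩ := tau_bound' (ρ := 1/2) ht0 ht1 (by norm_num) (by norm_num)
  unfold GG
  have hs : Summable fun m : ℕ => (C * (1/2)^x) * (1/2:ℝ)^m :=
    (summable_geometric_of_lt_one (by norm_num) (by norm_num)).mul_left _
  refine continuous_tsum (fun m => (tau_cont t m x).comp (by fun_prop)) hs fun m u => ?_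
  refine (h m x _ (div_nonneg (le_max_right _ _) (by positivity))).trans (le_of_eq ?_)
  rw [pow_add]; ring

lemma Qf_exp_bound {δ v : ℝ} (hδ0 : 0 < δ) (hδ1 : δ ≤ 1) (hv : 0 ≤ v) (k : ℕ) :
    |Qf k v| ≤ (δ⁻¹)^k * (2 * Real.exp (-((1-δ)*v))) := by
  have hq : ∀ k, qf k v ≤ (δ⁻¹)^k * Real.exp (-((1-δ)*v)) := by
    intro k
    have h1 := Real.pow_div_factorial_le_exp (δ*v) (by positivity) k
    have h2 : qf k v = (δ⁻¹)^k * (Real.exp (-v) * ((δ*v)^k / k.factorial)) := by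
      unfold qf; rw [mul_pow, inv_pow]; field_simp
    rw [h2, show -((1-δ)*v) = -v + δ*v by ring, Real.exp_add]
    gcongr
  rw [abs_of_nonneg (Qf_nonneg k hv)]
  unfold Qf
  have h3 := hq k
  have hE := Real.exp_pos (-((1-δ)*v))
  have h5 : 0 ≤ (δ⁻¹)^k := by positivity
  split_ifs
  · have h4 := hq (k-1)
    have : (δ⁻¹)^(k-1) ≤ (δ⁻¹)^k :=
      pow_le_pow_right₀ ((one_le_inv₀ hδ0).2 hδ1) (by omega)
    nlinarith
  · nlinarith

open Filter Topology in
lemma GG_pos_ex {t : ℝ} (ht0 : 0 < t) (ht1 : t < 1) (x : ℕ) : ∃ u, 0 < u ∧ 0 < GG t x u := by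
  set δ := (1-t)/2 with hδ
  have hδ0 : 0 < δ := by rw [hδ]; linarith
  have hδ1 : δ ≤ 1 := by rw [hδ]; linarith
  obtain ⟨C, hC, hb⟩ := tau_bound_gen (K := δ⁻¹) (ρ := 1/2) ht0 ht1 (by norm_num) (by norm_num)
    ((one_le_inv₀ hδ0).2 hδ1)
  set c := (1-δ)/t - 1 with hc
  have hc0 : 0 < c := by
    rw [hc, sub_pos, lt_div_iff₀ ht0, hδ]; linarith
  -- tail bound
  have htail : ∀ u, 0 < u → |∑' m : ℕ, tau t (m+1) x (u/t^(m+1))| ≤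
      (C * 4) * Real.exp (-((1-δ)/t*u)) := by
    intro u hu
    have hs : HasSum (fun m : ℕ => (C * 2 * Real.exp (-((1-δ)/t*u))) * (1/2:ℝ)^m)
        ((C * 2 * Real.exp (-((1-δ)/t*u))) * 2) := hasSum_geometric_two.mul_left _
    have := tsum_of_norm_bounded hs (f := fun m => tau t (m+1) x (u/t^(m+1))) fun m => by
      have h1 := hb (m+1) x (u/t^(m+1)) _ (by positivity)
        (Qf_exp_bound hδ0 hδ1 (v := u/t^(m+1)) (by positivity))
      refine h1.trans ?_
      have e1 : (1/2:ℝ)^(m+1+x) ≤ (1/2)^m :=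
        pow_le_pow_of_le_one (by norm_num) (by norm_num) (by omega)
      have e2 : Real.exp (-((1-δ)*(u/t^(m+1)))) ≤ Real.exp (-((1-δ)/t*u)) := by
        apply Real.exp_le_exp.2
        have : u/t ≤ u/t^(m+1) := by
          apply div_le_div_of_nonneg_left hu.le (by positivity)
          rw [pow_succ]
          exact mul_le_of_le_one_left ht0.le (pow_le_one₀ ht0.le ht1.le)
        have h3 : (1-δ)*(u/t) ≤ (1-δ)*(u/t^(m+1)) := by
          apply mul_le_mul_of_nonneg_left this; linarith
        have h4 : (1-δ)/t*u = (1-δ)*(u/t) := by ring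
        linarith
      calc _ ≤ C * (1/2)^m * (2 * Real.exp (-((1-δ)/t*u))) := by gcongr
        _ = _ := by ring
    refine this.trans (le_of_eq (by ring))
  have hq : ∀ k, k ≤ x → Tendsto (fun u : ℝ => Real.exp u / u^x * qf k u) atTop
      (𝓝 (if k = x then ((x.factorial:ℝ))⁻¹ else 0)) := by
    intro k hk
    have e : ∀ᶠ u : ℝ in atTop, Real.exp u / u^x * qf k u = (u^k/u^x) * (k.factorial:ℝ)⁻¹ := by
      filter_upwards with u
      unfold qf
      rw [Real.exp_neg]
      have := (Real.exp_pos u).ne'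
      field_simp
    refine Tendsto.congr' (EventuallyEq.symm e) ?_
    split_ifs with h
    · subst h
      refine Tendsto.congr' ?_ tendsto_const_nhds
      filter_upwards [eventually_gt_atTop 0] with u hu
      rw [div_self (by positivity), one_mul]
    · have := (tendsto_pow_div_pow_atTop_zero (𝕜 := ℝ) (lt_of_le_of_ne hk h)).mul_const
        ((k.factorial:ℝ)⁻¹)
      simpa using this
  have hQ : ∀ k, k ≤ x → Tendsto (fun u : ℝ => Real.exp u / u^x * Qf k u) atTop
      (𝓝 (if k = x then ((x.factorial:ℝ))⁻¹ else 0)) := by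
    intro k hk
    unfold Qf
    by_cases h1 : 1 ≤ k
    · have h2 := (hq k hk).add (hq (k-1) (by omega))
      rw [if_neg (show ¬ (k-1 = x) by omega), add_zero] at h2
      simpa [h1, mul_add] using h2
    · simpa [h1] using hq k hk
  have h0 : Tendsto (fun u : ℝ => Real.exp u / u^x * tau t 0 x u) atTop
      (𝓝 (t^(x.choose 2) * ((x.factorial:ℝ))⁻¹)) := by
    have h1 : Tendsto (fun u : ℝ => ∑ k ∈ Finset.range (x+1),
        (bb t x k * tBinomN t k 0) * (Real.exp u / u^x * Qf k u)) atTop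
        (𝓝 (∑ k ∈ Finset.range (x+1), (bb t x k * tBinomN t k 0) *
          (if k = x then ((x.factorial:ℝ))⁻¹ else 0))) :=
      tendsto_finsetSum _ fun k hk =>
        (hQ k (Nat.lt_succ_iff.1 (Finset.mem_range.1 hk))).const_mul _
    have e : ∑ k ∈ Finset.range (x+1), (bb t x k * tBinomN t k 0) *
          (if k = x then ((x.factorial:ℝ))⁻¹ else 0) = ((x.factorial:ℝ))⁻¹ := by
      simp [bb, aa, tPochN_zero, gb_zero ht0 ht1]
    rw [e] at h1
    refine (h1.const_mul (t^(x.choose 2))).congr fun u => ?_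
    simp only [tau]
    simp only [zero_add, pow_zero, one_mul, Nat.choose_zero_succ, add_zero]
    rw [mul_left_comm, Finset.mul_sum (Finset.range (x+1)) _ (Real.exp u / u^x)]
    congr 1
    apply Finset.sum_congr rfl
    intro k _
    ring
  have hT : Tendsto (fun u : ℝ => Real.exp u / u^x * ∑' m : ℕ, tau t (m+1) x (u/t^(m+1))) atTop
      (𝓝 0) := by
    have h1 : Tendsto (fun u : ℝ => (C*4) * Real.exp (-(c*u))) atTop (𝓝 ((C*4) * 0)) := by
      apply Tendsto.const_mul
      exact Real.tendsto_exp_neg_atTop_nhds_zero.comp (tendsto_id.const_mul_atTop hc0)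
    rw [mul_zero] at h1
    apply squeeze_zero_norm' _ h1
    filter_upwards [eventually_ge_atTop 1] with u hu
    have hu0 : 0 < u := by linarith
    rw [norm_mul, Real.norm_eq_abs, Real.norm_eq_abs, abs_of_pos (by positivity)]
    have h2 : Real.exp u / u^x ≤ Real.exp u := div_le_self (Real.exp_pos u).le (one_le_pow₀ hu)
    calc _ ≤ Real.exp u * ((C * 4) * Real.exp (-((1-δ)/t*u))) :=
          mul_le_mul h2 (htail u hu0) (abs_nonneg _) (Real.exp_pos u).le
      _ = (C*4) * (Real.exp u * Real.exp (-((1-δ)/t*u))) := by ring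
      _ = _ := by rw [← Real.exp_add, hc]; congr 2; ring
  have hsum := h0.add hT
  rw [add_zero] at hsum
  have hev := hsum.eventually (lt_mem_nhds (show 0 < t^(x.choose 2) * ((x.factorial:ℝ))⁻¹ by positivity))
  obtain ⟨u, h1, hu⟩ := (hev.and (eventually_gt_atTop 0)).exists
  refine ⟨u, hu, ?_⟩
  have h2 : GG t x u = tau t 0 x u + ∑' m : ℕ, tau t (m+1) x (u/t^(m+1)) := by
    unfold GG
    rw [(GG_summable ht0 ht1 x hu.le).of_abs.tsum_eq_zero_add]; simp
  rw [← mul_add, ← h2] at h1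
  exact pos_of_mul_pos_right h1 (by positivity)

lemma GG_nonneg {t : ℝ} (ht0 : 0 < t) (ht1 : t < 1) (x : ℕ) (u : ℝ) (hu : 0 < u) :
    0 ≤ GG t x u := by
  obtain ⟨C, hC, hb⟩ := GG_bound ht0 ht1
  have hti : 0 < t⁻¹ := by positivity
  have := pos_abs ht0 ht1 (fun x u => GG t x (max u 0)) (GG_cont ht0 ht1) C (1/2) (by norm_num)
    (by norm_num) (fun x u hu => by simpa [max_eq_left hu] using hb x u hu)
    (fun x => by simp [GG_zero ht0 ht1]) (fun x u hu => by
      have h := GG_deriv ht0 ht1 x u hu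
      have h2 : 0 ≤ t⁻¹ * u := by positivity
      simp only [max_eq_left hu.le, max_eq_left h2]
      refine h.congr_of_eventuallyEq ?_
      filter_upwards [lt_mem_nhds hu] with v hv
      rw [max_eq_left hv.le])
    (fun x => by
      obtain ⟨u, hu, h⟩ := GG_pos_ex ht0 ht1 x
      exact ⟨u, hu, by simpa [max_eq_left hu.le] using h⟩) x u hu
  simpa [max_eq_left hu.le] using this

open Filter Topology in
lemma euler_one {t : ℝ} (ht0 : 0 < t) (ht1 : t < 1) :
    ∑' n : ℕ, t^(n.choose 2) * aa t n = 0 := by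
  obtain ⟨C, hC, h⟩ := tchoose_bound (t := t) (σ := 1/2) ht0 ht1 (by norm_num) (by norm_num)
  have hP := tPochInf_pos ht0 ht1
  have hpart : ∀ N : ℕ, ∑ n ∈ Finset.range (N+1), t^(n.choose 2) * aa t n
      = t^((N+1).choose 2) * aa t N := by
    intro N
    induction N with
    | zero => simp
    | succ N ih =>
      rw [Finset.sum_range_succ, ih, choose_two_succ (N+1), pow_add, aa_succ ht0 ht1 N]
      ring
  have hs : Summable fun n : ℕ => t^(n.choose 2) * aa t n := by
    have hg : Summable fun m : ℕ => (C * (tPochInf t)⁻¹) * (1/2:ℝ)^m :=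
      (summable_geometric_of_lt_one (by norm_num) (by norm_num)).mul_left _
    refine Summable.of_norm_bounded hg fun n => ?_
    rw [Real.norm_eq_abs, abs_mul, abs_of_pos (by positivity)]
    calc _ ≤ (C * (1/2)^n) * (tPochInf t)⁻¹ := by
          have := h n
          have := aa_abs ht0 ht1 n
          gcongr
      _ = _ := by ring
  have h1 := (tendsto_add_atTop_iff_nat 1).2 hs.hasSum.tendsto_sum_nat
  simp only [hpart] at h1
  refine tendsto_nhds_unique h1 ?_
  have hz : Tendsto (fun n : ℕ => (C * (tPochInf t)⁻¹) * (1/2:ℝ)^(n+1)) atTop (𝓝 0) := by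
    have := (tendsto_pow_atTop_nhds_zero_of_lt_one (r := (1/2:ℝ)) (by norm_num) (by norm_num))
    have := ((tendsto_add_atTop_iff_nat 1).2 this).const_mul (C * (tPochInf t)⁻¹)
    simpa using this
  refine squeeze_zero_norm (fun n => ?_) hz
  rw [Real.norm_eq_abs, abs_mul, abs_of_pos (by positivity)]
  calc _ ≤ (C * (1/2)^(n+1)) * (tPochInf t)⁻¹ := by
        have := h (n+1)
        have := aa_abs ht0 ht1 n
        gcongr
    _ = _ := by ring

lemma qbinom_thm {t : ℝ} (ht0 : 0 < t) (ht1 : t < 1) (N : ℕ) :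
    ∑ n ∈ Finset.range (N+1), (-1)^n * t^((n+1).choose 2) * tBinomN t N n = tPochN t N := by
  induction N with
  | zero => simp [gb_zero ht0 ht1, tPochN_zero]
  | succ N ih =>
    have h1 : ∑ n ∈ Finset.range (N+1), (-1)^(n+1) * t^((n+1+1).choose 2) * tBinomN t N (n+1)
        + (-1)^0 * t^((0+1).choose 2) * tBinomN t N 0 = tPochN t N := by
      rw [← Finset.sum_range_succ' (fun n => (-1)^n * t^((n+1).choose 2) * tBinomN t N n),
        Finset.sum_range_succ, ih, gb_lt t (by omega)]
      simp
    have h2 : ∑ n ∈ Finset.range (N+1), (-1)^(n+1) * t^((n+1+1).choose 2) * tBinomN t (N+1) (n+1)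
       = ∑ n ∈ Finset.range (N+1), (-1)^(n+1) * t^((n+1+1).choose 2) * tBinomN t N (n+1)
        - t^(N+1) * tPochN t N := by
      rw [← ih, Finset.mul_sum, ← Finset.sum_sub_distrib]
      refine Finset.sum_congr rfl fun n hn => ?_
      have hn' : n ≤ N := Nat.lt_succ_iff.1 (Finset.mem_range.1 hn)
      obtain ⟨i, rfl⟩ := Nat.exists_eq_add_of_le hn'
      rw [gb_pascal1 ht0 ht1, choose_two_succ (n+1), show n + i - n = i by omega]
      ring
    rw [Finset.sum_range_succ', h2, tPochN_succ, gb_zero ht0 ht1]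
    rw [gb_zero ht0 ht1] at h1
    linear_combination h1

open Filter Topology in
lemma euler_two {t : ℝ} (ht0 : 0 < t) (ht1 : t < 1) :
    ∑' x : ℕ, t^((x+1).choose 2) * aa t x = tPochInf t := by
  obtain ⟨C, hC, h⟩ := tchoose_bound (t := t) (σ := 1/2) ht0 ht1 (by norm_num) (by norm_num)
  have hP := tPochInf_pos ht0 ht1
  have hg : Summable fun m : ℕ => (C * (tPochInf t)⁻¹) * (1/2:ℝ)^(m+1) :=
    (summable_nat_add_iff 1).2
      ((summable_geometric_of_lt_one (r := (1/2:ℝ)) (by norm_num) (by norm_num)).mul_left _)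
  have hlim := tendsto_tsum_of_dominated_convergence (𝓕 := atTop)
    (f := fun N n : ℕ => (-1)^n * t^((n+1).choose 2) * tBinomN t N n)
    (g := fun n => t^((n+1).choose 2) * aa t n) hg (fun n => ?_)
    (Filter.Eventually.of_forall fun N n => ?_)
  · have he : ∀ N : ℕ, ∑' n : ℕ, (-1)^n * t^((n+1).choose 2) * tBinomN t N n = tPochN t N := by
      intro N
      rw [← qbinom_thm ht0 ht1 N]
      refine tsum_eq_sum fun n hn => ?_
      rw [gb_lt t (by simp at hn; omega), mul_zero]
    simp only [he] at hlim
    exact tendsto_nhds_unique hlim (tPoch_tendsto ht0 ht1)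
  · have h1 := tPoch_tendsto ht0 ht1
    rw [← tendsto_add_atTop_iff_nat n]
    have h2 : Tendsto (fun i => (-1)^n * t^((n+1).choose 2) *
        (tPochN t (i+n) / (tPochN t n * tPochN t i))) atTop
        (𝓝 ((-1)^n * t^((n+1).choose 2) * (tPochInf t / (tPochN t n * tPochInf t)))) := by
      apply Tendsto.const_mul
      apply Tendsto.div
      · exact (tendsto_add_atTop_iff_nat n).2 h1
      · exact h1.const_mul _
      · exact (mul_pos (tPochN_pos ht0 ht1 n) hP).ne'
    have e1 : (-1)^n * t^((n+1).choose 2) * (tPochInf t / (tPochN t n * tPochInf t)) =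
        t^((n+1).choose 2) * aa t n := by
      unfold aa
      have := (tPochN_pos ht0 ht1 n).ne'
      field_simp
    rw [e1] at h2
    refine h2.congr fun i => ?_
    rw [add_comm i n, gb_add]
  · rw [Real.norm_eq_abs, abs_mul, abs_mul, abs_pow, abs_neg, abs_one, one_pow, one_mul,
      abs_of_pos (by positivity), abs_of_nonneg (gb_nonneg ht0 ht1 _ _)]
    calc _ ≤ (C * (1/2)^(n+1)) * (tPochInf t)⁻¹ := by
          have := h (n+1)
          have := gb_le ht0 ht1 N n
          have := gb_nonneg ht0 ht1 N n
          gcongr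
      _ = _ := by ring

lemma tsum_antidiag {f : ℕ × ℕ → ℝ} (hf : Summable f) :
    HasSum (fun n => ∑ m ∈ Finset.range (n+1), f (m, n-m)) (∑' p, f p) := by
  have h1 : Summable (f ∘ Finset.HasAntidiagonal.sigmaAntidiagonalEquivProd) :=
    (Equiv.summable_iff Finset.HasAntidiagonal.sigmaAntidiagonalEquivProd).2 hf
  have h2 := h1.hasSum.sigma (g := fun n => ∑ m ∈ Finset.range (n+1), f (m, n-m)) (fun n => ?_)
  · have h3 := Finset.HasAntidiagonal.sigmaAntidiagonalEquivProd.tsum_eq f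
    rwa [show ∑' p, f p = _ from h3.symm]
  · have := hasSum_fintype (fun c : Finset.HasAntidiagonal.antidiagonal n =>
      (f ∘ Finset.HasAntidiagonal.sigmaAntidiagonalEquivProd) ⟨n, c⟩)
    convert this using 1
    rw [← Nat.succ_eq_add_one, ← Finset.Nat.sum_antidiagonal_eq_sum_range_succ_mk,
      ← Finset.sum_coe_sort]
    rfl

lemma geo2 (D : ℝ) : Summable fun p : ℕ × ℕ => D * (1/2:ℝ)^(p.1+p.2) := by
  have hs := summable_geometric_of_lt_one (r := (1/2:ℝ)) (by norm_num) (by norm_num)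
  have := (hs.mul_of_nonneg hs (fun _ => by positivity) (fun _ => by positivity)).mul_left D
  simpa [pow_add] using this

noncomputable def hh (t : ℝ) (m : ℕ) (v : ℝ) : ℝ := ∑' x : ℕ, tau t m x v

lemma tau_prod_summable {t : ℝ} (ht0 : 0 < t) (ht1 : t < 1) {v : ℝ} (hv : 0 ≤ v) :
    Summable fun p : ℕ × ℕ => tau t p.1 p.2 v := by
  obtain ⟨C, hC, -, h, -⟩ := tau_bound' (ρ := 1/2) ht0 ht1 (by norm_num) (by norm_num)
  exact Summable.of_norm_bounded (geo2 C) fun p => h _ _ _ hv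

lemma tau_total {t : ℝ} (ht0 : 0 < t) (ht1 : t < 1) {v : ℝ} (hv : 0 ≤ v) :
    ∑' p : ℕ × ℕ, tau t p.1 p.2 v = 0 := by
  have h1 := (tsum_antidiag (tau_prod_summable ht0 ht1 hv)).tsum_eq
  rw [← h1]
  have h2 : ∀ n : ℕ, ∑ m ∈ Finset.range (n+1), tau t m (n-m) v =
      Real.exp (-v) * (t^(n.choose 2) * aa t n) := by
    intro n
    have h3 : ∀ m ∈ Finset.range (n+1), tau t m (n-m) v = ∑ k ∈ Finset.range (n+1),
        t^(n.choose 2) * bb t n k * Qf k v * ((-1)^m * t^(m.choose 2) * tBinomN t k m) := by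
      intro m hm
      have : m + (n-m) = n := by have := Finset.mem_range.1 hm; omega
      unfold tau
      rw [this, Finset.mul_sum, pow_add]
      refine Finset.sum_congr rfl fun k _ => by ring
    rw [Finset.sum_congr rfl h3, Finset.sum_comm]
    simp only [← Finset.mul_sum]
    rw [Finset.sum_range_succ', Finset.sum_eq_zero]
    · rw [Finset.sum_range_succ', Finset.sum_eq_zero]
      · simp [gb_zero ht0 ht1, Qf, qf, bb]; ring
      · intro m _
        rw [gb_lt t (by omega), mul_zero]
    · intro k hk
      rw [qbinom ht0 ht1, gb_lt t (Finset.mem_range.1 hk)]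
      simp
  simp only [h2]
  rw [tsum_mul_left, euler_one ht0 ht1, mul_zero]

lemma hh_hasSum {t : ℝ} (ht0 : 0 < t) (ht1 : t < 1) {v : ℝ} (hv : 0 ≤ v) :
    HasSum (fun m => hh t m v) 0 := by
  have h1 := tau_prod_summable ht0 ht1 hv
  have h2 := h1.hasSum.prod_fiberwise (fun m => (h1.prod_factor m).hasSum)
  rwa [tau_total ht0 ht1 hv] at h2

lemma hh_bound {t : ℝ} (ht0 : 0 < t) (ht1 : t < 1) :
    ∃ C : ℝ, 0 ≤ C ∧ (∀ m v, 0 ≤ v → |hh t m v| ≤ C * (1/2)^m / (1+v^2)) ∧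
      (∀ m v, 0 ≤ v → |hh t m v| ≤ C * (1/2)^m) := by
  obtain ⟨C, hC, h, -, -⟩ := tau_bound' (ρ := 1/2) ht0 ht1 (by norm_num) (by norm_num)
  have h1 : ∀ m v, 0 ≤ v → |hh t m v| ≤ C * 2 * (1/2)^m / (1+v^2) := by
    intro m v hv
    have hs : HasSum (fun x : ℕ => (C * (1/2)^m / (1+v^2)) * (1/2:ℝ)^x)
      (C * (1/2)^m / (1+v^2) * 2) := hasSum_geometric_two.mul_left _
    have := tsum_of_norm_bounded hs (f := fun x => tau t m x v) fun x => by
      refine (h m x v hv).trans (le_of_eq ?_)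
      rw [pow_add]; ring
    refine this.trans (le_of_eq (by ring))
  refine ⟨C*2, by positivity, h1, fun m v hv => (h1 m v hv).trans ?_⟩
  exact div_le_self (by positivity) (by nlinarith)

lemma hh_zero_ge (t : ℝ) (m : ℕ) (h : 2 ≤ m) : hh t m 0 = 0 := by
  simp [hh, tau_zero_ge t m _ h]

lemma hh_zero_one {t : ℝ} (ht0 : 0 < t) (ht1 : t < 1) : hh t 1 0 = - tPochInf t := by
  simp only [hh, tau_zero_one ht0 ht1]
  rw [tsum_neg, euler_two ht0 ht1]

open Filter Topology in
lemma hh_tendsto {t : ℝ} (ht0 : 0 < t) (ht1 : t < 1) (m : ℕ) {u : ℕ → ℝ} (hu : ∀ n, 0 ≤ u n)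
    (hl : Tendsto u atTop (𝓝 0)) : Tendsto (fun n => hh t m (u n)) atTop (𝓝 (hh t m 0)) := by
  obtain ⟨C, hC, -, h, -⟩ := tau_bound' (ρ := 1/2) ht0 ht1 (by norm_num) (by norm_num)
  unfold hh
  have hs : Summable fun x : ℕ => C * (1/2:ℝ)^(m+x) := (geo2 C).prod_factor m
  refine tendsto_tsum_of_dominated_convergence hs (fun x => ?_)
    (Filter.Eventually.of_forall fun n x => h _ _ _ (hu n))
  exact ((tau_cont t m x).tendsto 0).comp hl

noncomputable def BB (t u : ℝ) : ℝ := ∑' x : ℕ, GG t x u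

lemma GG_x_summable {t : ℝ} (ht0 : 0 < t) (ht1 : t < 1) {u : ℝ} (hu : 0 ≤ u) :
    Summable fun x : ℕ => GG t x u := by
  obtain ⟨C, hC, h⟩ := GG_bound ht0 ht1
  have hg : Summable fun m : ℕ => (C / (1+u^2)) * (1/2:ℝ)^m :=
    (summable_geometric_of_lt_one (by norm_num) (by norm_num)).mul_left _
  refine Summable.of_norm_bounded hg fun x => (h x u hu).trans (le_of_eq (by ring))

lemma BB_eq {t : ℝ} (ht0 : 0 < t) (ht1 : t < 1) {u : ℝ} (hu : 0 ≤ u) :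
    BB t u = ∑' m : ℕ, hh t m (u/t^m) := by
  obtain ⟨C, hC, -, h, -⟩ := tau_bound' (ρ := 1/2) ht0 ht1 (by norm_num) (by norm_num)
  unfold BB GG hh
  refine (Summable.tsum_comm (f := fun m x => tau t m x (u/t^m)) ?_)
  refine Summable.of_norm_bounded (geo2 C) fun p => ?_
  exact h p.1 p.2 (u/t^p.1) (by positivity)

lemma shm_summable {t : ℝ} (ht0 : 0 < t) (ht1 : t < 1) {u : ℝ} (hu : 0 < u) :
    Summable fun p : ℕ × ℕ => hh t p.1 (u/t^(p.1+p.2)) := by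
  obtain ⟨C, hC, h, -⟩ := hh_bound ht0 ht1
  have hs := summable_geometric_of_lt_one (r := (1/2:ℝ)) (by norm_num) (by norm_num)
  have hs2 := summable_geometric_of_lt_one ht0.le ht1
  have hg := (hs.mul_of_nonneg hs2 (fun _ => by positivity) (fun _ => by positivity)).mul_left (C / u)
  refine Summable.of_norm_bounded hg fun p => ?_
  have hv : 0 < u/t^(p.1+p.2) := by positivity
  refine (h p.1 _ hv.le).trans ?_
  have h1 : u / t^p.2 ≤ u/t^(p.1+p.2) := by
    apply div_le_div_of_nonneg_left hu.le (by positivity)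
    exact pow_le_pow_of_le_one ht0.le ht1.le (by omega)
  have h2 : u / t^p.2 ≤ 1 + (u/t^(p.1+p.2))^2 := by nlinarith [sq_nonneg (u/t^(p.1+p.2) - 1)]
  calc _ ≤ C * (1/2)^p.1 / (u / t^p.2) := by gcongr
    _ = _ := by field_simp

noncomputable def WW (t u : ℝ) : ℝ := ∑' s : ℕ, BB t (u/t^s)

lemma BB_s_hasSum {t : ℝ} (ht0 : 0 < t) (ht1 : t < 1) {u : ℝ} (hu : 0 < u) :
    HasSum (fun s : ℕ => BB t (u/t^s)) (∑' p : ℕ × ℕ, hh t p.1 (u/t^(p.1+p.2))) := by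
  have h1 := shm_summable ht0 ht1 hu
  have h1' := h1.prod_symm
  have h2 := h1'.hasSum.prod_fiberwise (fun m => (h1'.prod_factor m).hasSum)
  have e : ∑' p : ℕ × ℕ, hh t p.1 (u/t^(p.1+p.2)) =
      ∑' b : ℕ × ℕ, hh t (b.swap).1 (u / t^((b.swap).1 + (b.swap).2)) :=
    ((Equiv.prodComm ℕ ℕ).tsum_eq (fun p : ℕ × ℕ => hh t p.1 (u/t^(p.1+p.2)))).symm
  rw [e]
  convert h2 using 1
  funext s
  rw [BB_eq ht0 ht1 (by positivity)]
  refine tsum_congr fun m => ?_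
  simp only [Prod.swap]
  rw [div_div, ← pow_add, add_comm]

lemma WW_eq {t : ℝ} (ht0 : 0 < t) (ht1 : t < 1) {u : ℝ} (hu : 0 < u) :
    WW t u = ∑' r : ℕ, - ∑' j : ℕ, hh t (j+(r+1)) (u/t^r) := by
  rw [WW, (BB_s_hasSum ht0 ht1 hu).tsum_eq, ← (tsum_antidiag (shm_summable ht0 ht1 hu)).tsum_eq]
  refine tsum_congr fun r => ?_
  have hv : 0 ≤ u/t^r := by positivity
  have h1 := hh_hasSum ht0 ht1 hv
  have h2 := h1.summable.sum_add_tsum_nat_add (r+1)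
  rw [h1.tsum_eq] at h2
  have h3 : ∑ m ∈ Finset.range (r+1), hh t m (u/t^(m+(r-m))) =
      ∑ m ∈ Finset.range (r+1), hh t m (u/t^r) := by
    refine Finset.sum_congr rfl fun m hm => ?_
    have := Finset.mem_range.1 hm
    rw [show m + (r-m) = r by omega]
  simp only
  rw [h3]
  linarith

open Filter Topology in
lemma WW_tendsto {t : ℝ} (ht0 : 0 < t) (ht1 : t < 1) {u : ℕ → ℝ} (hu : ∀ n, 0 < u n)
    (hl : Tendsto u atTop (𝓝 0)) : Tendsto (fun n => WW t (u n)) atTop (𝓝 (tPochInf t)) := by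
  obtain ⟨C, hC, -, h⟩ := hh_bound ht0 ht1
  simp only [fun n => WW_eq ht0 ht1 (hu n)]
  have hlim : ∑' r : ℕ, - ∑' j : ℕ, hh t (j+(r+1)) 0 = tPochInf t := by
    rw [tsum_eq_single 0, tsum_eq_single 0]
    · simp [hh_zero_one ht0 ht1]
    · intro j hj
      exact hh_zero_ge t _ (by omega)
    · intro r hr
      have : ∀ j : ℕ, hh t (j+(r+1)) 0 = 0 := fun j => hh_zero_ge t _ (by omega)
      simp [this]
  rw [← hlim]
  have hs := summable_geometric_of_lt_one (r := (1/2:ℝ)) (by norm_num) (by norm_num)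
  refine tendsto_tsum_of_dominated_convergence (hs.mul_left (C*2)) (fun r => ?_)
    (Filter.Eventually.of_forall fun n r => ?_)
  · apply Tendsto.neg
    refine tendsto_tsum_of_dominated_convergence (hs.mul_left C) (fun j => ?_)
      (Filter.Eventually.of_forall fun n j => ?_)
    · refine hh_tendsto ht0 ht1 _ (fun n => div_nonneg (hu n).le (by positivity)) ?_
      simpa using hl.div_const (t^r)
    · refine (h _ _ (div_nonneg (hu n).le (by positivity))).trans ?_
      have : (1/2:ℝ)^(j+(r+1)) ≤ (1/2)^j :=
        pow_le_pow_of_le_one (by norm_num) (by norm_num) (by omega)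
      gcongr
  · rw [norm_neg]
    have hs2 : HasSum (fun j : ℕ => (C * (1/2)^r) * (1/2:ℝ)^j) (C * (1/2)^r * 2) :=
      hasSum_geometric_two.mul_left _
    have := tsum_of_norm_bounded hs2 (f := fun j => hh t (j+(r+1)) (u n/t^r)) fun j => by
      refine (h _ _ (div_nonneg (hu n).le (by positivity))).trans ?_
      have : (1/2:ℝ)^(j+(r+1)) ≤ (1/2)^(r+j) :=
        pow_le_pow_of_le_one (by norm_num) (by norm_num) (by omega)
      rw [mul_assoc, ← pow_add]
      gcongr
    refine this.trans (le_of_eq (by ring))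

open Filter Topology in
lemma BB_total {t χ : ℝ} (ht0 : 0 < t) (ht1 : t < 1) (hχ : 0 < χ) :
    HasSum (fun L : ℤ => BB t (χ * t^L)) (tPochInf t) := by
  have hpos : ∀ L : ℤ, 0 ≤ BB t (χ * t^L) := fun L =>
    tsum_nonneg fun x => GG_nonneg ht0 ht1 x _ (by positivity)
  have hneg : HasSum (fun s : ℕ => BB t (χ * t^(-(s:ℤ)))) (WW t χ) := by
    have h1 := (BB_s_hasSum ht0 ht1 hχ).summable.hasSum
    refine (h1.congr_fun ?_)
    intro s
    rw [zpow_neg, zpow_natCast, div_eq_mul_inv]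
  have hWN : ∀ N : ℕ, WW t (χ * t^N) = ∑ n ∈ Finset.range N, BB t (χ * t^((n:ℤ)+1)) + WW t χ := by
    intro N
    have h1 := (BB_s_hasSum ht0 ht1 (u := χ * t^N) (by positivity)).summable.sum_add_tsum_nat_add N
    rw [WW, ← h1, WW]
    congr 1
    · rw [← Finset.sum_range_reflect]
      refine Finset.sum_congr rfl fun n hn => ?_
      have hn' := Finset.mem_range.1 hn
      congr 1
      rw [mul_div_assoc]
      congr 1
      rw [div_eq_iff (by positivity), ← zpow_natCast, ← zpow_natCast, ← zpow_add₀ ht0.ne']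
      congr 1
      omega
    · refine tsum_congr fun s => ?_
      congr 1
      rw [pow_add]; field_simp
  have hl : Tendsto (fun N : ℕ => χ * t^N) atTop (𝓝 0) := by
    simpa using (tendsto_pow_atTop_nhds_zero_of_lt_one ht0.le ht1).const_mul χ
  have h1 := WW_tendsto ht0 ht1 (fun N => by positivity) hl
  have h2 : HasSum (fun n : ℕ => BB t (χ * t^((n:ℤ)+1))) (tPochInf t - WW t χ) := by
    rw [hasSum_iff_tendsto_nat_of_nonneg (fun n => hpos _)]
    have := h1.sub_const (WW t χ)
    refine this.congr fun N => ?_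
    rw [hWN]; ring
  have h3 : HasSum (fun L : ℤ => BB t (χ * t^(L+1))) (tPochInf t - WW t χ + WW t χ) := by
    refine HasSum.of_nat_of_neg_add_one h2 ?_
    refine hneg.congr_fun fun s => ?_
    congr 3
    ring
  rw [sub_add_cancel] at h3
  exact (Equiv.addRight (1:ℤ)).hasSum_iff.1 h3

lemma Fweight_eq {t : ℝ} (ht0 : 0 < t) (ht1 : t < 1) (χ : ℝ) (L : ℤ) (x : ℕ) :
    Fweight t χ L x = (tPochInf t)⁻¹ * GG t x (χ * t^L) := by
  unfold Fweight GG
  simp only [Fterm_eq ht0 ht1]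

theorem stmt16 (t χ : ℝ) (ht0 : 0 < t) (ht1 : t < 1) (hχ : 0 < χ) :
    (∀ (L : ℤ) (x : ℕ), Summable fun m : ℕ => |Fterm t χ L x m|) ∧
    (∀ (L : ℤ) (x : ℕ), 0 ≤ Fweight t χ L x) ∧
    (Summable fun p : ℤ × ℕ => Fweight t χ p.1 p.2) ∧
    ∑' (L : ℤ), ∑' (x : ℕ), Fweight t χ L x = 1 := by
  have hP := tPochInf_pos ht0 ht1
  have hu : ∀ L : ℤ, 0 < χ * t^L := fun L => by positivity
  have hF : ∀ (L : ℤ) (x : ℕ), 0 ≤ Fweight t χ L x := fun L x => by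
    rw [Fweight_eq ht0 ht1]
    exact mul_nonneg (by positivity) (GG_nonneg ht0 ht1 x _ (hu L))
  have hB := (BB_total ht0 ht1 hχ).mul_left (tPochInf t)⁻¹
  rw [inv_mul_cancel₀ hP.ne'] at hB
  have hx : ∀ L : ℤ, ∑' x : ℕ, Fweight t χ L x = (tPochInf t)⁻¹ * BB t (χ * t^L) := fun L => by
    simp only [Fweight_eq ht0 ht1]
    rw [tsum_mul_left, BB]
  refine ⟨fun L x => ?_, hF, ?_, ?_⟩
  · simp only [Fterm_eq ht0 ht1]
    exact GG_summable ht0 ht1 x (hu L).le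
  · rw [summable_prod_of_nonneg (fun p => hF p.1 p.2)]
    refine ⟨fun L => ?_, ?_⟩
    · simp only [Fweight_eq ht0 ht1]
      exact (GG_x_summable ht0 ht1 (hu L).le).mul_left _
    · simp only [hx]
      exact hB.summable
  · simp only [hx]
    exact hB.tsum_eq
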